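/- There exist linear functionals ξ̂_L, ξ̂_R ∈ A* such that for all x ∈ A: ξ_R x = ⟨ξ̂_L, x_{(2)}⟩ x_{(1)}, ξ_L x = ⟨ξ̂_L, x_{(1)}⟩ x_{(2)}, x ξ_L = ⟨ξ̂_R, x_{(1)}⟩ x_{(2)}, and x ξ_R = ⟨ξ̂_R, x_{(2)}⟩ x_{(1)}. -/

import Mathlib

open scoped TensorProduct

noncomputable section

/-- An element of a `C*`-algebra is positive iff it is of the form `star y * y`. -/
def IsPosElem {A : Type*} [Mul A] [Star A] (x : A) : Prop := ∃ y : A, x = star y * y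

section Helpers

variable {A : Type*} [NormedRing A] [StarRing A] [CStarRing A]
  [NormedAlgebra ℂ A] [StarModule ℂ A]

/-- Apply a linear functional to the first leg of a tensor (`⟨φ, u₁⟩ u₂`). -/
def lapp (φ : A →ₗ[ℂ] ℂ) : A ⊗[ℂ] A →ₗ[ℂ] A :=
  (TensorProduct.lid ℂ A).toLinearMap ∘ₗ TensorProduct.map φ LinearMap.id

/-- Apply a linear functional to the second leg of a tensor (`⟨φ, u₂⟩ u₁`). -/
def rapp (φ : A →ₗ[ℂ] ℂ) : A ⊗[ℂ] A →ₗ[ℂ] A :=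
  (TensorProduct.rid ℂ A).toLinearMap ∘ₗ TensorProduct.map LinearMap.id φ

/-- Apply a pair of linear functionals to the two legs of a tensor (`⟨φ, u₁⟩⟨ψ, u₂⟩`). -/
def papp (φ ψ : A →ₗ[ℂ] ℂ) : A ⊗[ℂ] A →ₗ[ℂ] ℂ :=
  (TensorProduct.lid ℂ ℂ).toLinearMap ∘ₗ TensorProduct.map φ ψ

end Helpers

/-- A `C*`-weak Hopf algebra: a finite-dimensional unital `C*`-algebra `A` equipped with a
comultiplication `Δ` (written in Sweedler notation `Δ x = x₍₁₎ ⊗ x₍₂₎`), counit `ε` and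
antipode `S`, satisfying the axioms of Böhm–Szlachányi.  The field `starT` is the
(componentwise) star operation on `A ⊗[ℂ] A`, characterized by additivity and its values on
pure tensors. -/
structure WeakHopfData (A : Type*) [NormedRing A] [StarRing A] [CStarRing A]
    [NormedAlgebra ℂ A] [StarModule ℂ A] [FiniteDimensional ℂ A] : Type _ where
  Δ : A →ₗ[ℂ] A ⊗[ℂ] A
  ε : A →ₗ[ℂ] ℂ
  S : A ≃ₗ[ℂ] A
  starT : A ⊗[ℂ] A → A ⊗[ℂ] A
  starT_add : ∀ u v : A ⊗[ℂ] A, starT (u + v) = starT u + starT v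
  starT_tmul : ∀ a b : A, starT (a ⊗ₜ[ℂ] b) = star a ⊗ₜ[ℂ] star b
  /-- coassociativity of the comultiplication -/
  coassoc : (TensorProduct.assoc ℂ A A A).toLinearMap ∘ₗ
      (TensorProduct.map Δ LinearMap.id) ∘ₗ Δ = (TensorProduct.map LinearMap.id Δ) ∘ₗ Δ
  /-- counit axiom, left version -/
  counit_left : (TensorProduct.lid ℂ A).toLinearMap ∘ₗ (TensorProduct.map ε LinearMap.id) ∘ₗ Δ
      = LinearMap.id
  /-- counit axiom, right version -/
  counit_right : (TensorProduct.rid ℂ A).toLinearMap ∘ₗ (TensorProduct.map LinearMap.id ε) ∘ₗ Δ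
      = LinearMap.id
  /-- the comultiplication is multiplicative -/
  Δ_mul : ∀ x y : A, Δ (x * y) = Δ x * Δ y
  /-- the star operation is comultiplicative -/
  Δ_star : ∀ x : A, Δ (star x) = starT (Δ x)
  /-- the unit is weakly comultiplicative:
  `(Δ ⊗ id)(Δ 1) = (Δ 1 ⊗ 1)(1 ⊗ Δ 1)` -/
  Δ_one_weak : (TensorProduct.map Δ LinearMap.id) (Δ 1)
      = (Δ 1 ⊗ₜ[ℂ] (1 : A)) * ((TensorProduct.assoc ℂ A A A).symm ((1 : A) ⊗ₜ[ℂ] Δ 1))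
  /-- the unit is weakly comultiplicative:
  `(Δ ⊗ id)(Δ 1) = (1 ⊗ Δ 1)(Δ 1 ⊗ 1)` -/
  Δ_one_weak' : (TensorProduct.map Δ LinearMap.id) (Δ 1)
      = ((TensorProduct.assoc ℂ A A A).symm ((1 : A) ⊗ₜ[ℂ] Δ 1)) * (Δ 1 ⊗ₜ[ℂ] (1 : A))
  /-- the counit is weakly multiplicative: `ε (x y z) = ε (x y₍₁₎) ε (y₍₂₎ z)` -/
  ε_weak : ∀ x y z : A,
      ε (x * y * z) = papp (ε ∘ₗ LinearMap.mulLeft ℂ x) (ε ∘ₗ LinearMap.mulRight ℂ z) (Δ y)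
  /-- the counit is weakly multiplicative: `ε (x y z) = ε (x y₍₂₎) ε (y₍₁₎ z)` -/
  ε_weak' : ∀ x y z : A,
      ε (x * y * z) = papp (ε ∘ₗ LinearMap.mulRight ℂ z) (ε ∘ₗ LinearMap.mulLeft ℂ x) (Δ y)
  /-- antipode axiom: `x₍₁₎ S(x₍₂₎) = ε (1₍₁₎ x) 1₍₂₎` -/
  antipode_left : ∀ x : A,
      LinearMap.mul' ℂ A ((TensorProduct.map LinearMap.id S.toLinearMap) (Δ x))
        = lapp (ε ∘ₗ LinearMap.mulRight ℂ x) (Δ 1)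
  /-- antipode axiom: `S(x₍₁₎) x₍₂₎ = 1₍₁₎ ε (x 1₍₂₎)` -/
  antipode_right : ∀ x : A,
      LinearMap.mul' ℂ A ((TensorProduct.map S.toLinearMap LinearMap.id) (Δ x))
        = rapp (ε ∘ₗ LinearMap.mulLeft ℂ x) (Δ 1)
  /-- the antipode is antimultiplicative -/
  S_antimul : ∀ x y : A, S (x * y) = S y * S x
  /-- the antipode is anticomultiplicative -/
  S_anticomul : ∀ x : A,
      Δ (S x) = (TensorProduct.comm ℂ A A) ((TensorProduct.map S.toLinearMap S.toLinearMap) (Δ x))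

namespace WeakHopfData

variable {A : Type*} [NormedRing A] [StarRing A] [CStarRing A]
  [NormedAlgebra ℂ A] [StarModule ℂ A] [FiniteDimensional ℂ A]

/-- The source counital map `ε^L (x) = x₍₁₎ S(x₍₂₎)`. -/
def εL (W : WeakHopfData A) : A →ₗ[ℂ] A :=
  LinearMap.mul' ℂ A ∘ₗ TensorProduct.map LinearMap.id W.S.toLinearMap ∘ₗ W.Δ

/-- The target counital map `ε^R (x) = S(x₍₁₎) x₍₂₎`. -/
def εR (W : WeakHopfData A) : A →ₗ[ℂ] A :=
  LinearMap.mul' ℂ A ∘ₗ TensorProduct.map W.S.toLinearMap LinearMap.id ∘ₗ W.Δ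

/-- Full contraction of the iterated coproduct `Δ⁽ⁿ⁾ x = x₍₁₎ ⊗ ⋯ ⊗ x₍ₙ₊₁₎` against a family
of `n+1` linear functionals: `sweedlerEval W n φ x = ⟨φ 0, x₍₁₎⟩ ⋯ ⟨φ n, x₍ₙ₊₁₎⟩`.
Since linear functionals separate the points of a tensor power, identities between iterated
coproducts are faithfully expressed through these contractions. -/
def sweedlerEval (W : WeakHopfData A) : (n : ℕ) → (Fin (n + 1) → (A →ₗ[ℂ] ℂ)) → (A →ₗ[ℂ] ℂ)
  | 0, φ => φ 0
  | n + 1, φ => papp (sweedlerEval W n (Fin.init φ)) (φ (Fin.last (n + 1))) ∘ₗ W.Δ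

end WeakHopfData

/-- A `C*`-weak Hopf algebra together with its canonical distinguished elements:
the Haar integral `h`, the dual Haar integral `hHat`, the square roots `gL`, `gR` of
`E^L h`, `E^R h` (whence the canonical grouplike element `g = gL * gR⁻¹`), real powers
`gLpow`, `gRpow` of `gL` and `gR`, and a positive square root operation `sqrt`;
all characterized by the (uniquely determining) properties listed as fields. -/
structure HaarPkg (A : Type*) [NormedRing A] [StarRing A] [CStarRing A]
    [NormedAlgebra ℂ A] [StarModule ℂ A] [FiniteDimensional ℂ A] : Type _ where
  W : WeakHopfData A
  /-- the Haar integral -/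
  h : A
  haar_left : ∀ x : A, x * h = WeakHopfData.εL W x * h
  haar_right : ∀ x : A, h * x = h * WeakHopfData.εR W x
  haar_counitL : WeakHopfData.εL W h = 1
  haar_counitR : WeakHopfData.εR W h = 1
  haar_idem : h * h = h
  haar_star : star h = h
  haar_S : W.S h = h
  haar_nondeg : ∀ y : A, ∃ φ ψ : A →ₗ[ℂ] ℂ, lapp φ (W.Δ h) = y ∧ rapp ψ (W.Δ h) = y
  /-- the Haar integral of the dual weak Hopf algebra `A*`, as a linear functional on `A` -/
  hHat : A →ₗ[ℂ] ℂ
  hHat_pos : ∀ x : A, ∃ r : ℝ, 0 ≤ r ∧ hHat (star x * x) = (r : ℂ)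
  hHat_S : ∀ x : A, hHat (W.S x) = hHat x
  /-- `gL = (E^L h)^{1/2}` -/
  gL : A
  /-- `gR = (E^R h)^{1/2}` -/
  gR : A
  gL_pos : IsPosElem gL
  gR_pos : IsPosElem gR
  gL_unit : IsUnit gL
  gR_unit : IsUnit gR
  gL_sq : gL * gL = rapp hHat (W.Δ h)
  gR_sq : gR * gR = lapp hHat (W.Δ h)
  gL_mem : gL ∈ Set.range (WeakHopfData.εL W)
  gR_mem : gR ∈ Set.range (WeakHopfData.εR W)
  gR_S : gR = W.S gL
  gLR_comm : gL * gR = gR * gL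
  /-- the canonical grouplike element `g = gL * gR⁻¹` is positive -/
  g_pos : IsPosElem (gL * Ring.inverse gR)
  g_unit : IsUnit (gL * Ring.inverse gR)
  /-- `Δ g = (g ⊗ g) Δ 1` -/
  g_grouplike : W.Δ (gL * Ring.inverse gR)
      = ((gL * Ring.inverse gR) ⊗ₜ[ℂ] (gL * Ring.inverse gR)) * W.Δ 1
  /-- `Δ g = Δ 1 (g ⊗ g)` -/
  g_grouplike' : W.Δ (gL * Ring.inverse gR)
      = W.Δ 1 * ((gL * Ring.inverse gR) ⊗ₜ[ℂ] (gL * Ring.inverse gR))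
  /-- `S g = g⁻¹` -/
  g_S : W.S (gL * Ring.inverse gR) = Ring.inverse (gL * Ring.inverse gR)
  /-- `S² x = g x g⁻¹` -/
  S_sq : ∀ x : A,
      W.S (W.S x) = (gL * Ring.inverse gR) * x * Ring.inverse (gL * Ring.inverse gR)
  /-- `h₍₁₎ ⊗ g h₍₂₎ g = h₍₂₎ ⊗ h₍₁₎` -/
  haar_flip : TensorProduct.map LinearMap.id
      (LinearMap.mulLeft ℂ (gL * Ring.inverse gR) ∘ₗ LinearMap.mulRight ℂ (gL * Ring.inverse gR))
      (W.Δ h) = (TensorProduct.comm ℂ A A) (W.Δ h)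
  /-- dual integral relation `⟨ĥ, x (h gL⁻²)⟩ = ε x` -/
  hHat_dual₁ : ∀ x : A, hHat (x * (h * (Ring.inverse gL * Ring.inverse gL))) = W.ε x
  /-- dual integral relation `⟨ĥ, (gR⁻² h) x⟩ = ε x` -/
  hHat_dual₂ : ∀ x : A, hHat ((Ring.inverse gR * Ring.inverse gR * h) * x) = W.ε x
  /-- dual integral relation `⟨ĥ, (h gL⁻²)₍₂₎⟩ (h gL⁻²)₍₁₎ = 1` -/
  hHat_dual₃ : rapp hHat (W.Δ (h * (Ring.inverse gL * Ring.inverse gL))) = 1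
  /-- dual integral relation `⟨ĥ, (gR⁻² h)₍₁₎⟩ (gR⁻² h)₍₂₎ = 1` -/
  hHat_dual₄ : lapp hHat (W.Δ (Ring.inverse gR * Ring.inverse gR * h)) = 1
  /-- the positive square root, via the continuous functional calculus -/
  sqrt : A → A
  sqrt_pos : ∀ x : A, IsPosElem x → IsPosElem (sqrt x)
  sqrt_mul_self : ∀ x : A, IsPosElem x → sqrt x * sqrt x = x
  /-- real powers of `gL`, via the continuous functional calculus -/
  gLpow : ℝ → A
  /-- real powers of `gR`, via the continuous functional calculus -/
  gRpow : ℝ → A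
  gLpow_one : gLpow 1 = gL
  gRpow_one : gRpow 1 = gR
  gLpow_zero : gLpow 0 = 1
  gRpow_zero : gRpow 0 = 1
  gLpow_add : ∀ s t : ℝ, gLpow (s + t) = gLpow s * gLpow t
  gRpow_add : ∀ s t : ℝ, gRpow (s + t) = gRpow s * gRpow t
  gLpow_pos : ∀ t : ℝ, IsPosElem (gLpow t)
  gRpow_pos : ∀ t : ℝ, IsPosElem (gRpow t)
  gLpow_continuous : Continuous gLpow
  gRpow_continuous : Continuous gRpow

namespace HaarPkg

variable {A : Type*} [NormedRing A] [StarRing A] [CStarRing A]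
  [NormedAlgebra ℂ A] [StarModule ℂ A] [FiniteDimensional ℂ A]
variable (P : HaarPkg A)

/-- The canonical grouplike element `g = gL gR⁻¹`. -/
def g : A := P.gL * Ring.inverse P.gR

/-- The Watatani index `ı = ε^L (h gL⁻²)` of the Haar conditional expectations. -/
def iotaEl : A := WeakHopfData.εL P.W (P.h * (Ring.inverse P.gL * Ring.inverse P.gL))

/-- The element `ȷ = ⟨ĥ, (gL⁻²)₍₁₎⟩ (gL⁻²)₍₂₎`, the dual analogue of the Watatani index. -/
def jayEl : A := lapp P.hHat (P.W.Δ (Ring.inverse P.gL * Ring.inverse P.gL))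

/-- The pulling-through element `Ω = ı⁻¹ gL⁻¹ h gL⁻¹`. -/
def Ω : A := Ring.inverse P.iotaEl * Ring.inverse P.gL * P.h * Ring.inverse P.gL

/-- The map `J x = g^{-1/2} S(x) g^{1/2}`, as a linear map. -/
def Jlin : A →ₗ[ℂ] A :=
  LinearMap.mulRight ℂ (P.sqrt P.g) ∘ₗ
    LinearMap.mulLeft ℂ (Ring.inverse (P.sqrt P.g)) ∘ₗ P.W.S.toLinearMap

/-- The functional `⟨ω, x⟩ = ⟨ĥ, ȷ⁻¹ gL⁻¹ gR⁻¹ x⟩` (the dual analogue of `Ω`). -/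
def ω : A →ₗ[ℂ] ℂ :=
  P.hHat ∘ₗ LinearMap.mulLeft ℂ (Ring.inverse P.jayEl * (Ring.inverse P.gL * Ring.inverse P.gR))

/-- `ξ_L = ı^{1/2} ȷ^{1/2} gL`. -/
def ξL : A := P.sqrt P.iotaEl * P.sqrt P.jayEl * P.gL

/-- `ξ_R = ı^{1/2} ȷ^{1/2} gR`. -/
def ξR : A := P.sqrt P.iotaEl * P.sqrt P.jayEl * P.gR

/-- `ξ = ξ_L ξ_R`. -/
def ξ : A := P.ξL * P.ξR

/-- `J^L x = gL⁻¹ S(x) gL`. -/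
def JL : A → A := fun x => Ring.inverse P.gL * P.W.S x * P.gL

/-- `J^R x = gL S⁻¹(x) gL⁻¹`. -/
def JR : A → A := fun x => P.gL * P.W.S.symm x * Ring.inverse P.gL

end HaarPkg

theorem IsPosElem.isSelfAdjoint {A : Type*} [NonUnitalSemiring A] [StarRing A] {x : A}
    (hx : IsPosElem x) : IsSelfAdjoint x := by
  obtain ⟨y, rfl⟩ := hx
  exact IsSelfAdjoint.star_mul_self y

theorem IsPosElem.star_mul_mul {A : Type*} [NonUnitalSemiring A] [StarRing A] {x : A}
    (hx : IsPosElem x) (c : A) : IsPosElem (star c * x * c) := by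
  obtain ⟨y, rfl⟩ := hx
  exact ⟨y * c, by simp only [star_mul, mul_assoc]⟩

theorem LinearMap.map_star_of_nonneg {A : Type*} [Ring A] [StarRing A] [Algebra ℂ A]
    [StarModule ℂ A] {φ : A →ₗ[ℂ] ℂ}
    (hφ : ∀ x : A, ∃ r : ℝ, 0 ≤ r ∧ φ (star x * x) = (r : ℂ)) (x : A) :
    φ (star x) = star (φ x) := by
  have hsa : ∀ a : A, IsSelfAdjoint a → star (φ a) = φ a := by
    intro a ha
    obtain ⟨r, -, hr⟩ := hφ (1 + a)
    obtain ⟨s, -, hs⟩ := hφ (1 - a)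
    have h4 : (4 : ℂ) • a = star (1 + a) * (1 + a) - star (1 - a) * (1 - a) := by
      rw [star_add, star_sub, star_one, ha.star_eq, ofNat_smul_eq_nsmul]
      noncomm_ring
    have h5 : (4 : ℂ) * φ a = ((r - s : ℝ) : ℂ) := by
      rw [← smul_eq_mul, ← map_smul, h4, map_sub, hr, hs, Complex.ofReal_sub]
    have h6 : φ a = (((r - s) / 4 : ℝ) : ℂ) := by
      push_cast at h5 ⊢
      rw [← h5]; ring
    rw [h6, Complex.star_def, Complex.conj_ofReal]
  rw [← realPart_add_I_smul_imaginaryPart x]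
  simp only [star_add, star_smul, map_add, map_smul, smul_eq_mul, star_mul',
    (realPart x).2.star_eq, (imaginaryPart x).2.star_eq, hsa _ (realPart x).2,
    hsa _ (imaginaryPart x).2]

section CStar

variable {A : Type*} [NormedRing A] [StarRing A] [CStarRing A]
  [NormedAlgebra ℂ A] [StarModule ℂ A] [FiniteDimensional ℂ A]

variable (A) in
/-- A finite-dimensional `C*`-algebra is complete, hence an instance of `CStarAlgebra`. -/
abbrev finiteDimensionalCStarAlgebra : CStarAlgebra A :=
  { ‹NormedRing A›, ‹StarRing A›, ‹CStarRing A›, ‹NormedAlgebra ℂ A›, ‹StarModule ℂ A› with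
    toCompleteSpace := FiniteDimensional.complete ℂ A }

theorem IsPosElem.sum_star_mul_self {ι : Type*} (s : Finset ι) (c : ι → A) :
    IsPosElem (∑ i ∈ s, star (c i) * c i) := by
  let _ := finiteDimensionalCStarAlgebra A
  let _ := CStarAlgebra.spectralOrder A
  have := CStarAlgebra.spectralOrderedRing A
  obtain ⟨y, hy⟩ := CStarAlgebra.nonneg_iff_eq_star_mul_self.mp
    (Finset.sum_nonneg fun i (_ : i ∈ s) => star_mul_self_nonneg (c i))
  exact ⟨y, hy⟩

open Polynomial in
/-- A positive square root of `x` is a polynomial in `x`. -/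
theorem IsPosElem.mem_of_mul_self {b : A} (hb : IsPosElem b) (B : Subalgebra ℂ A)
    (hB : b * b ∈ B) : b ∈ B := by
  let _ := finiteDimensionalCStarAlgebra A
  let _ := CStarAlgebra.spectralOrder A
  have := CStarAlgebra.spectralOrderedRing A
  have : FiniteDimensional ℝ A := FiniteDimensional.complexToReal A
  have hsa : IsSelfAdjoint b := hb.isSelfAdjoint
  have hnonneg : 0 ≤ b := by
    obtain ⟨y, rfl⟩ := hb
    exact star_mul_self_nonneg y
  have hfin : (spectrum ℝ b).Finite := by
    rcases subsingleton_or_nontrivial A with _ | _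
    · simp
    refine (minpoly ℝ b).rootSet_finite ℝ |>.subset fun r hr => ?_
    have h0 := spectrum.subset_polynomial_aeval b (minpoly ℝ b) ⟨r, hr, rfl⟩
    rw [minpoly.aeval, spectrum.zero_eq] at h0
    rw [mem_rootSet]
    exact ⟨minpoly.ne_zero (Algebra.IsIntegral.isIntegral b), by simpa [aeval_def] using h0⟩
  have hinj : Set.InjOn (fun r : ℝ => r * r) hfin.toFinset := by
    intro r hr s hs hrs
    have hr' := spectrum_nonneg_of_nonneg hnonneg (hfin.mem_toFinset.mp hr)
    have hs' := spectrum_nonneg_of_nonneg hnonneg (hfin.mem_toFinset.mp hs)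
    exact (mul_self_inj hr' hs').mp hrs
  set p : ℝ[X] := Lagrange.interpolate hfin.toFinset (fun r => r * r) id with hp
  have hpb : aeval (b * b) p = b := by
    have h1 : aeval b (p.comp (X * X)) = b := by
      rw [← cfc_polynomial (p.comp (X * X)) b hsa]
      refine (cfc_congr fun r hr => ?_).trans (cfc_id ℝ b hsa)
      have := Lagrange.eval_interpolate_at_node id hinj (hfin.mem_toFinset.mpr hr)
      rw [← hp] at this
      simpa [eval_comp, -Lagrange.interpolate_apply, hp] using this
    simpa [aeval_comp] using h1
  rw [← hpb]
  exact (B.restrictScalars ℝ).toSubsemiring.mem_carrier.mp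
    (Polynomial.aeval_mem_adjoin_singleton ℝ (b * b) |> fun h =>
      (Algebra.adjoin_le (S := B.restrictScalars ℝ) (by simpa using hB)) h)

open scoped ComplexOrder MatrixOrder in
/-- Positive functionals are completely positive. -/
theorem IsPosElem.sum_smul_of_nonneg {φ : A →ₗ[ℂ] ℂ}
    (hφ : ∀ x : A, ∃ r : ℝ, 0 ≤ r ∧ φ (star x * x) = (r : ℂ))
    {ι : Type*} [Fintype ι] (a b : ι → A) :
    IsPosElem (∑ i, ∑ j, φ (star (b i) * b j) • (star (a i) * a j)) := by
  classical
  let M : Matrix ι ι ℂ := fun i j => φ (star (b i) * b j)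
  have hM : M.PosSemidef := by
    refine .of_dotProduct_mulVec_nonneg ?_ fun x => ?_
    · ext i j
      change star (φ (star (b j) * b i)) = φ (star (b i) * b j)
      rw [← LinearMap.map_star_of_nonneg hφ, star_mul, star_star]
    · obtain ⟨r, hr, hr'⟩ := hφ (∑ i, x i • b i)
      have : star x ⬝ᵥ M.mulVec x = (r : ℂ) := by
        rw [← hr']
        simp only [star_sum, star_smul, Finset.sum_mul_sum, map_sum, smul_mul_smul_comm,
          map_smul, smul_eq_mul]
        simp only [dotProduct, Matrix.mulVec, Finset.mul_sum, M, Pi.star_apply]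
        exact Finset.sum_congr rfl fun i _ => Finset.sum_congr rfl fun j _ => by ring
      rw [this]
      exact_mod_cast hr
  obtain ⟨B, hB⟩ := CStarAlgebra.nonneg_iff_eq_star_mul_self.mp hM.nonneg
  have hMB : ∀ i j, φ (star (b i) * b j) = ∑ k, star (B k i) * B k j := fun i j => by
    have := congrFun (congrFun hB i) j
    simpa [M, Matrix.mul_apply, Matrix.star_eq_conjTranspose] using this
  convert IsPosElem.sum_star_mul_self Finset.univ (fun k => ∑ i, B k i • a i) using 1
  simp only [hMB, Finset.sum_smul, star_sum, star_smul, Finset.sum_mul_sum, smul_mul_smul_comm]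
  exact (Finset.sum_congr rfl fun i _ => Finset.sum_comm).trans Finset.sum_comm

end CStar

/-- In a finite-dimensional algebra, a subalgebra is closed under inversion. -/
theorem Subalgebra.ringInverse_mem {K A : Type*} [Field K] [Ring A] [Algebra K A]
    [FiniteDimensional K A] (B : Subalgebra K A) {y : A} (hy : y ∈ B) (hu : IsUnit y) :
    Ring.inverse y ∈ B := by
  have hinj : Function.Injective (LinearMap.mulLeft K (⟨y, hy⟩ : B)) := fun a b hab =>
    Subtype.ext (hu.mul_left_cancel (congrArg Subtype.val hab))
  obtain ⟨z, hz⟩ := (LinearMap.injective_iff_surjective.mp hinj) 1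
  have hz' : y * (z : A) = 1 := congrArg Subtype.val hz
  rw [← mul_one (Ring.inverse y), ← hz', Ring.inverse_mul_cancel_left _ _ hu]
  exact z.2

section Slices

variable {A : Type*} [NormedRing A] [NormedAlgebra ℂ A]

@[simp]
theorem lapp_tmul (φ : A →ₗ[ℂ] ℂ) (a b : A) : lapp φ (a ⊗ₜ[ℂ] b) = φ a • b := rfl

@[simp]
theorem rapp_tmul (φ : A →ₗ[ℂ] ℂ) (a b : A) : rapp φ (a ⊗ₜ[ℂ] b) = φ b • a := rfl

@[simp]
theorem papp_tmul (φ ψ : A →ₗ[ℂ] ℂ) (a b : A) : papp φ ψ (a ⊗ₜ[ℂ] b) = φ a * ψ b := rfl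

theorem lapp_tmul_one_mul (φ : A →ₗ[ℂ] ℂ) (y : A) (u : A ⊗[ℂ] A) :
    lapp φ ((y ⊗ₜ[ℂ] 1) * u) = lapp (φ ∘ₗ LinearMap.mulLeft ℂ y) u := by
  induction u with
  | zero => simp
  | add u v hu hv => simp [mul_add, hu, hv]
  | tmul a b => simp

theorem lapp_mul_tmul_one (φ : A →ₗ[ℂ] ℂ) (y : A) (u : A ⊗[ℂ] A) :
    lapp φ (u * (y ⊗ₜ[ℂ] 1)) = lapp (φ ∘ₗ LinearMap.mulRight ℂ y) u := by
  induction u with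
  | zero => simp
  | add u v hu hv => simp [add_mul, hu, hv]
  | tmul a b => simp

theorem rapp_one_tmul_mul (φ : A →ₗ[ℂ] ℂ) (z : A) (u : A ⊗[ℂ] A) :
    rapp φ ((1 ⊗ₜ[ℂ] z) * u) = rapp (φ ∘ₗ LinearMap.mulLeft ℂ z) u := by
  induction u with
  | zero => simp
  | add u v hu hv => simp [mul_add, hu, hv]
  | tmul a b => simp

theorem rapp_mul_one_tmul (φ : A →ₗ[ℂ] ℂ) (z : A) (u : A ⊗[ℂ] A) :
    rapp φ (u * (1 ⊗ₜ[ℂ] z)) = rapp (φ ∘ₗ LinearMap.mulRight ℂ z) u := by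
  induction u with
  | zero => simp
  | add u v hu hv => simp [add_mul, hu, hv]
  | tmul a b => simp

theorem rapp_tmul_one_mul (φ : A →ₗ[ℂ] ℂ) (y : A) (u : A ⊗[ℂ] A) :
    rapp φ ((y ⊗ₜ[ℂ] 1) * u) = y * rapp φ u := by
  induction u with
  | zero => simp
  | add u v hu hv => simp [mul_add, hu, hv]
  | tmul a b => simp

theorem papp_mulRight_mulLeft (φ : A →ₗ[ℂ] ℂ) (x z : A) (u : A ⊗[ℂ] A) :
    papp (φ ∘ₗ LinearMap.mulRight ℂ z) (φ ∘ₗ LinearMap.mulLeft ℂ x) u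
      = φ (rapp (φ ∘ₗ LinearMap.mulLeft ℂ x) u * z) := by
  induction u with
  | zero => simp
  | add u v hu hv => simp [add_mul, hu, hv]
  | tmul a b => simp [mul_comm]

theorem papp_mulRight_mulLeft' (φ : A →ₗ[ℂ] ℂ) (x z : A) (u : A ⊗[ℂ] A) :
    papp (φ ∘ₗ LinearMap.mulRight ℂ z) (φ ∘ₗ LinearMap.mulLeft ℂ x) u
      = φ (x * lapp (φ ∘ₗ LinearMap.mulRight ℂ z) u) := by
  induction u with
  | zero => simp
  | add u v hu hv => simp [mul_add, hu, hv]
  | tmul a b => simp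

/-- Slicing the two outer legs of a triple tensor in either order. -/
theorem lapp_rapp_assoc (φ ψ : A →ₗ[ℂ] ℂ) (w : (A ⊗[ℂ] A) ⊗[ℂ] A) :
    lapp φ (TensorProduct.rid ℂ (A ⊗[ℂ] A) (TensorProduct.map LinearMap.id ψ w))
      = rapp ψ (TensorProduct.lid ℂ (A ⊗[ℂ] A)
          (TensorProduct.map φ LinearMap.id (TensorProduct.assoc ℂ A A A w))) := by
  induction w with
  | zero => simp
  | add u v hu hv => simp only [map_add, hu, hv]
  | tmul u c =>
    induction u with
    | zero => simp
    | add u v hu hv => simp only [TensorProduct.add_tmul, map_add, hu, hv]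
    | tmul a b => simp [smul_smul, mul_comm]

theorem lid_map_assoc_mul (φ : A →ₗ[ℂ] ℂ) (u v : A ⊗[ℂ] A) :
    TensorProduct.lid ℂ (A ⊗[ℂ] A) (TensorProduct.map φ LinearMap.id
      (TensorProduct.assoc ℂ A A A
        ((u ⊗ₜ[ℂ] (1 : A)) * (TensorProduct.assoc ℂ A A A).symm ((1 : A) ⊗ₜ[ℂ] v))))
      = (lapp φ u ⊗ₜ[ℂ] 1) * v := by
  induction u with
  | zero => simp
  | add u u' hu hu' => simp only [TensorProduct.add_tmul, add_mul, map_add, hu, hu']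
  | tmul a b =>
    induction v with
    | zero => simp
    | add v v' hv hv' => simp only [TensorProduct.tmul_add, mul_add, map_add, hv, hv']
    | tmul c d => simp [TensorProduct.smul_tmul']

theorem lid_map_assoc_mul' (φ : A →ₗ[ℂ] ℂ) (u v : A ⊗[ℂ] A) :
    TensorProduct.lid ℂ (A ⊗[ℂ] A) (TensorProduct.map φ LinearMap.id
      (TensorProduct.assoc ℂ A A A
        ((TensorProduct.assoc ℂ A A A).symm ((1 : A) ⊗ₜ[ℂ] v) * (u ⊗ₜ[ℂ] (1 : A)))))
      = v * (lapp φ u ⊗ₜ[ℂ] 1) := by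
  induction u with
  | zero => simp
  | add u u' hu hu' => simp only [TensorProduct.add_tmul, mul_add, map_add, hu, hu']
  | tmul a b =>
    induction v with
    | zero => simp
    | add v v' hv hv' => simp only [TensorProduct.tmul_add, add_mul, map_add, hv, hv']
    | tmul c d => simp [TensorProduct.smul_tmul']

theorem rid_map_mul (φ : A →ₗ[ℂ] ℂ) (u v : A ⊗[ℂ] A) :
    TensorProduct.rid ℂ (A ⊗[ℂ] A) (TensorProduct.map LinearMap.id φ
        ((u ⊗ₜ[ℂ] (1 : A)) * (TensorProduct.assoc ℂ A A A).symm ((1 : A) ⊗ₜ[ℂ] v)))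
      = u * (1 ⊗ₜ[ℂ] rapp φ v) := by
  induction v with
  | zero => simp
  | add v v' hv hv' => simp only [TensorProduct.tmul_add, mul_add, map_add, hv, hv']
  | tmul c d => simp

theorem rid_map_mul' (φ : A →ₗ[ℂ] ℂ) (u v : A ⊗[ℂ] A) :
    TensorProduct.rid ℂ (A ⊗[ℂ] A) (TensorProduct.map LinearMap.id φ
        ((TensorProduct.assoc ℂ A A A).symm ((1 : A) ⊗ₜ[ℂ] v) * (u ⊗ₜ[ℂ] (1 : A))))
      = (1 ⊗ₜ[ℂ] rapp φ v) * u := by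
  induction v with
  | zero => simp
  | add v v' hv hv' => simp only [TensorProduct.tmul_add, add_mul, map_add, hv, hv']
  | tmul c d => simp

end Slices

namespace WeakHopfData

variable {A : Type*} [NormedRing A] [StarRing A] [CStarRing A]
  [NormedAlgebra ℂ A] [StarModule ℂ A] [FiniteDimensional ℂ A] (W : WeakHopfData A)

theorem Δ_lapp (φ : A →ₗ[ℂ] ℂ) (u : A ⊗[ℂ] A) : W.Δ (lapp φ u)
    = TensorProduct.lid ℂ (A ⊗[ℂ] A)
        (TensorProduct.map φ LinearMap.id (TensorProduct.map LinearMap.id W.Δ u)) := by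
  induction u with
  | zero => simp
  | add u v hu hv => simp only [map_add, hu, hv]
  | tmul a b => simp

theorem Δ_rapp (φ : A →ₗ[ℂ] ℂ) (u : A ⊗[ℂ] A) : W.Δ (rapp φ u)
    = TensorProduct.rid ℂ (A ⊗[ℂ] A)
        (TensorProduct.map LinearMap.id φ (TensorProduct.map W.Δ LinearMap.id u)) := by
  induction u with
  | zero => simp
  | add u v hu hv => simp only [map_add, hu, hv]
  | tmul a b => simp

theorem coassoc_apply (x : A) : TensorProduct.map LinearMap.id W.Δ (W.Δ x)
    = TensorProduct.assoc ℂ A A A (TensorProduct.map W.Δ LinearMap.id (W.Δ x)) :=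
  (LinearMap.congr_fun W.coassoc x).symm

theorem lapp_ε_Δ (x : A) : lapp W.ε (W.Δ x) = x := LinearMap.congr_fun W.counit_left x

theorem rapp_ε_Δ (x : A) : rapp W.ε (W.Δ x) = x := LinearMap.congr_fun W.counit_right x

theorem Δ_injective : Function.Injective W.Δ :=
  Function.LeftInverse.injective W.lapp_ε_Δ

theorem Δ_mul_one (x : A) : W.Δ x * W.Δ 1 = W.Δ x := by rw [← W.Δ_mul, mul_one]

theorem Δ_one_mul (x : A) : W.Δ 1 * W.Δ x = W.Δ x := by rw [← W.Δ_mul, one_mul]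

/-- The left base algebra `A^L`, as the set of `y` with `Δ y = (y ⊗ 1) Δ 1 = Δ 1 (y ⊗ 1)`. -/
def baseL : Subalgebra ℂ A where
  carrier := {y | W.Δ y = (y ⊗ₜ[ℂ] 1) * W.Δ 1 ∧ W.Δ y = W.Δ 1 * (y ⊗ₜ[ℂ] 1)}
  mul_mem' := by
    rintro x y ⟨hx, hx'⟩ ⟨hy, hy'⟩
    constructor
    · rw [W.Δ_mul, hx, mul_assoc, W.Δ_one_mul, hy, ← mul_assoc,
        Algebra.TensorProduct.tmul_mul_tmul, one_mul]
    · rw [W.Δ_mul, hy', ← mul_assoc, W.Δ_mul_one, hx', mul_assoc,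
        Algebra.TensorProduct.tmul_mul_tmul, one_mul]
  add_mem' := by
    rintro x y ⟨hx, hx'⟩ ⟨hy, hy'⟩
    constructor
    · rw [map_add, hx, hy, TensorProduct.add_tmul, add_mul]
    · rw [map_add, hx', hy', TensorProduct.add_tmul, mul_add]
  algebraMap_mem' := fun r => by
    simp [Algebra.algebraMap_eq_smul_one, ← TensorProduct.smul_tmul',
      ← Algebra.TensorProduct.one_def]

/-- The right base algebra `A^R`, as the set of `z` with `Δ z = (1 ⊗ z) Δ 1 = Δ 1 (1 ⊗ z)`. -/
def baseR : Subalgebra ℂ A where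
  carrier := {z | W.Δ z = (1 ⊗ₜ[ℂ] z) * W.Δ 1 ∧ W.Δ z = W.Δ 1 * (1 ⊗ₜ[ℂ] z)}
  mul_mem' := by
    rintro x y ⟨hx, hx'⟩ ⟨hy, hy'⟩
    constructor
    · rw [W.Δ_mul, hx, mul_assoc, W.Δ_one_mul, hy, ← mul_assoc,
        Algebra.TensorProduct.tmul_mul_tmul, one_mul]
    · rw [W.Δ_mul, hy', ← mul_assoc, W.Δ_mul_one, hx', mul_assoc,
        Algebra.TensorProduct.tmul_mul_tmul, one_mul]
  add_mem' := by
    rintro x y ⟨hx, hx'⟩ ⟨hy, hy'⟩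
    constructor
    · rw [map_add, hx, hy, TensorProduct.tmul_add, add_mul]
    · rw [map_add, hx', hy', TensorProduct.tmul_add, mul_add]
  algebraMap_mem' := fun r => by
    simp [Algebra.algebraMap_eq_smul_one, ← Algebra.TensorProduct.one_def]

theorem lapp_Δ_one_mem_baseL (φ : A →ₗ[ℂ] ℂ) : lapp φ (W.Δ 1) ∈ W.baseL :=
  ⟨by rw [Δ_lapp, coassoc_apply, W.Δ_one_weak, lid_map_assoc_mul],
    by rw [Δ_lapp, coassoc_apply, W.Δ_one_weak', lid_map_assoc_mul']⟩

theorem rapp_Δ_one_mem_baseR (φ : A →ₗ[ℂ] ℂ) : rapp φ (W.Δ 1) ∈ W.baseR :=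
  ⟨by rw [Δ_rapp, W.Δ_one_weak', rid_map_mul'], by rw [Δ_rapp, W.Δ_one_weak, rid_map_mul]⟩

theorem εL_eq (x : A) : W.εL x = lapp (W.ε ∘ₗ LinearMap.mulRight ℂ x) (W.Δ 1) :=
  W.antipode_left x

theorem εR_eq (x : A) : W.εR x = rapp (W.ε ∘ₗ LinearMap.mulLeft ℂ x) (W.Δ 1) :=
  W.antipode_right x

theorem εL_mem_baseL (x : A) : W.εL x ∈ W.baseL := by
  rw [εL_eq]; exact W.lapp_Δ_one_mem_baseL _

theorem εR_mem_baseR (x : A) : W.εR x ∈ W.baseR := by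
  rw [εR_eq]; exact W.rapp_Δ_one_mem_baseR _

theorem εL_one : W.εL 1 = 1 := by
  rw [εL_eq, LinearMap.mulRight_one, LinearMap.comp_id, lapp_ε_Δ]

theorem εR_one : W.εR 1 = 1 := by
  rw [εR_eq, LinearMap.mulLeft_one, LinearMap.comp_id, rapp_ε_Δ]

theorem S_one : W.S 1 = 1 := by
  have h := W.S_antimul 1 (W.S.symm 1)
  rwa [one_mul, LinearEquiv.apply_symm_apply, one_mul, eq_comm] at h

theorem commute_of_mem {y z : A} (hy : y ∈ W.baseL) (hz : z ∈ W.baseR) : Commute y z := by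
  apply W.Δ_injective
  rw [W.Δ_mul, W.Δ_mul, hy.1, mul_assoc, W.Δ_one_mul, hz.1, ← mul_assoc, mul_assoc _ _ (_ * _),
    ← hy.1, W.Δ_one_mul, hy.1, ← mul_assoc]
  simp

theorem mul'_map_S_mul_tmul_one (y : A) (u : A ⊗[ℂ] A) :
    LinearMap.mul' ℂ A (TensorProduct.map W.S.toLinearMap LinearMap.id (u * (y ⊗ₜ[ℂ] 1)))
      = W.S y * LinearMap.mul' ℂ A (TensorProduct.map W.S.toLinearMap LinearMap.id u) := by
  induction u with
  | zero => simp
  | add u v hu hv => simp only [add_mul, mul_add, map_add, hu, hv]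
  | tmul a b => simp [W.S_antimul, mul_assoc]

theorem mul'_map_S_mul_one_tmul (z : A) (u : A ⊗[ℂ] A) :
    LinearMap.mul' ℂ A (TensorProduct.map W.S.toLinearMap LinearMap.id (u * (1 ⊗ₜ[ℂ] z)))
      = LinearMap.mul' ℂ A (TensorProduct.map W.S.toLinearMap LinearMap.id u) * z := by
  induction u with
  | zero => simp
  | add u v hu hv => simp only [add_mul, map_add, hu, hv]
  | tmul a b => simp [mul_assoc]

theorem mul'_map_id_one_tmul_mul (z : A) (u : A ⊗[ℂ] A) :
    LinearMap.mul' ℂ A (TensorProduct.map LinearMap.id W.S.toLinearMap ((1 ⊗ₜ[ℂ] z) * u))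
      = LinearMap.mul' ℂ A (TensorProduct.map LinearMap.id W.S.toLinearMap u) * W.S z := by
  induction u with
  | zero => simp
  | add u v hu hv => simp only [add_mul, mul_add, map_add, hu, hv]
  | tmul a b => simp [W.S_antimul, mul_assoc]

theorem εR_eq_S {y : A} (hy : y ∈ W.baseL) : W.εR y = W.S y := by
  have h := W.mul'_map_S_mul_tmul_one y (W.Δ 1)
  rw [← hy.2] at h
  exact h.trans ((congrArg _ W.εR_one).trans (mul_one _))

theorem εR_eq_self {z : A} (hz : z ∈ W.baseR) : W.εR z = z := by
  have h := W.mul'_map_S_mul_one_tmul z (W.Δ 1)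
  rw [← hz.2] at h
  exact h.trans ((congrArg (· * z) W.εR_one).trans (one_mul _))

theorem εL_eq_S {z : A} (hz : z ∈ W.baseR) : W.εL z = W.S z := by
  have h := W.mul'_map_id_one_tmul_mul z (W.Δ 1)
  rw [← hz.1] at h
  exact h.trans ((congrArg (· * W.S z) W.εL_one).trans (one_mul _))

theorem S_mem_baseR {y : A} (hy : y ∈ W.baseL) : W.S y ∈ W.baseR :=
  W.εR_eq_S hy ▸ W.εR_mem_baseR y

theorem S_eq_self {c : A} (hL : c ∈ W.baseL) (hR : c ∈ W.baseR) : W.S c = c := by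
  rw [← W.εR_eq_S hL, W.εR_eq_self hR]

theorem ε_mul_eq_εR (x y : A) : W.ε (x * y) = W.ε (W.εR x * y) := by
  rw [εR_eq, ← papp_mulRight_mulLeft, ← W.ε_weak', mul_one]

theorem ε_mul_eq_εL (x y : A) : W.ε (x * y) = W.ε (x * W.εL y) := by
  rw [εL_eq, ← papp_mulRight_mulLeft', ← W.ε_weak', mul_one]

variable {W}

theorem lapp_mulLeft_Δ {y : A} (hy : y ∈ W.baseL) (x : A) :
    lapp (W.ε ∘ₗ LinearMap.mulLeft ℂ y) (W.Δ x) = y * x := by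
  rw [← lapp_tmul_one_mul, ← W.Δ_one_mul x, ← mul_assoc, ← hy.1, ← W.Δ_mul, lapp_ε_Δ]

theorem lapp_mulRight_Δ {y : A} (hy : y ∈ W.baseL) (x : A) :
    lapp (W.ε ∘ₗ LinearMap.mulRight ℂ y) (W.Δ x) = x * y := by
  rw [← lapp_mul_tmul_one, ← W.Δ_mul_one x, mul_assoc, ← hy.2, ← W.Δ_mul, lapp_ε_Δ]

theorem rapp_mulLeft_Δ {z : A} (hz : z ∈ W.baseR) (x : A) :
    rapp (W.ε ∘ₗ LinearMap.mulLeft ℂ z) (W.Δ x) = z * x := by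
  rw [← rapp_one_tmul_mul, ← W.Δ_one_mul x, ← mul_assoc, ← hz.1, ← W.Δ_mul, rapp_ε_Δ]

theorem rapp_mulRight_Δ {z : A} (hz : z ∈ W.baseR) (x : A) :
    rapp (W.ε ∘ₗ LinearMap.mulRight ℂ z) (W.Δ x) = x * z := by
  rw [← rapp_mul_one_tmul, ← W.Δ_mul_one x, mul_assoc, ← hz.2, ← W.Δ_mul, rapp_ε_Δ]

variable (W)

theorem starT_zero : W.starT 0 = 0 := by
  simpa using W.starT_add 0 0

theorem starT_sum {ι : Type*} (s : Finset ι) (f : ι → A ⊗[ℂ] A) :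
    W.starT (∑ i ∈ s, f i) = ∑ i ∈ s, W.starT (f i) :=
  map_sum (⟨⟨W.starT, W.starT_zero⟩, W.starT_add⟩ : A ⊗[ℂ] A →+ A ⊗[ℂ] A) f s

theorem isPosElem_rapp {φ : A →ₗ[ℂ] ℂ}
    (hφ : ∀ x : A, ∃ r : ℝ, 0 ≤ r ∧ φ (star x * x) = (r : ℂ)) (u : A ⊗[ℂ] A) :
    IsPosElem (rapp φ (W.starT u * u)) := by
  obtain ⟨s, rfl⟩ := TensorProduct.exists_finset u
  simp only [← s.sum_coe_sort, starT_sum, W.starT_tmul, Finset.sum_mul_sum, map_sum, rapp_tmul,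
    Algebra.TensorProduct.tmul_mul_tmul]
  exact IsPosElem.sum_smul_of_nonneg hφ (fun i : s => i.1.1) (fun i => i.1.2)

theorem isPosElem_lapp {φ : A →ₗ[ℂ] ℂ}
    (hφ : ∀ x : A, ∃ r : ℝ, 0 ≤ r ∧ φ (star x * x) = (r : ℂ)) (u : A ⊗[ℂ] A) :
    IsPosElem (lapp φ (W.starT u * u)) := by
  obtain ⟨s, rfl⟩ := TensorProduct.exists_finset u
  simp only [← s.sum_coe_sort, starT_sum, W.starT_tmul, Finset.sum_mul_sum, map_sum, lapp_tmul,
    Algebra.TensorProduct.tmul_mul_tmul]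
  exact IsPosElem.sum_smul_of_nonneg hφ (fun i : s => i.1.2) (fun i => i.1.1)

theorem isPosElem_rapp_Δ {φ : A →ₗ[ℂ] ℂ}
    (hφ : ∀ x : A, ∃ r : ℝ, 0 ≤ r ∧ φ (star x * x) = (r : ℂ)) (x : A) :
    IsPosElem (rapp φ (W.Δ (star x * x))) := by
  rw [W.Δ_mul, W.Δ_star]
  exact W.isPosElem_rapp hφ _

theorem isPosElem_lapp_Δ {φ : A →ₗ[ℂ] ℂ}
    (hφ : ∀ x : A, ∃ r : ℝ, 0 ≤ r ∧ φ (star x * x) = (r : ℂ)) (x : A) :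
    IsPosElem (lapp φ (W.Δ (star x * x))) := by
  rw [W.Δ_mul, W.Δ_star]
  exact W.isPosElem_lapp hφ _

end WeakHopfData

namespace HaarPkg

open WeakHopfData

variable {A : Type*} [NormedRing A] [StarRing A] [CStarRing A]
  [NormedAlgebra ℂ A] [StarModule ℂ A] [FiniteDimensional ℂ A] (P : HaarPkg A)

theorem gL_mem_baseL : P.gL ∈ P.W.baseL := by
  obtain ⟨x, hx⟩ := P.gL_mem
  exact hx ▸ P.W.εL_mem_baseL x

theorem gR_mem_baseR : P.gR ∈ P.W.baseR := by
  obtain ⟨x, hx⟩ := P.gR_mem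
  exact hx ▸ P.W.εR_mem_baseR x

theorem gL_inv_mem_baseL : Ring.inverse P.gL ∈ P.W.baseL :=
  P.W.baseL.ringInverse_mem P.gL_mem_baseL P.gL_unit

theorem gR_inv_mem_baseR : Ring.inverse P.gR ∈ P.W.baseR :=
  P.W.baseR.ringInverse_mem P.gR_mem_baseR P.gR_unit

theorem star_gL_inv : star (Ring.inverse P.gL) = Ring.inverse P.gL := by
  rw [← Ring.inverse_star, P.gL_pos.isSelfAdjoint.star_eq]

theorem S_gL_inv : P.W.S (Ring.inverse P.gL) = Ring.inverse P.gR := by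
  have h : P.W.S (Ring.inverse P.gL) * P.gR = 1 := by
    rw [P.gR_S, ← P.W.S_antimul, Ring.mul_inverse_cancel _ P.gL_unit, P.W.S_one]
  rw [← Ring.mul_inverse_cancel_right _ (P.W.S (Ring.inverse P.gL)) P.gR_unit, h, one_mul]

theorem g_mul_gL_inv_sq_mul_g :
    P.g * (Ring.inverse P.gL * Ring.inverse P.gL) * P.g
      = P.W.S (Ring.inverse P.gL * Ring.inverse P.gL) := by
  rw [P.W.S_antimul, S_gL_inv, g,
    (P.W.commute_of_mem P.gL_mem_baseL P.gR_inv_mem_baseR).eq]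
  rw [mul_assoc, mul_assoc, mul_assoc, ← (P.W.commute_of_mem P.gL_mem_baseL P.gR_inv_mem_baseR).eq,
    Ring.inverse_mul_cancel_left _ _ P.gL_unit, Ring.mul_inverse_cancel_left _ _ P.gL_unit]

/-- `h₍₁₎ ⊗ h₍₂₎ = g S(h₍₁₎) g ⊗ S(h₍₂₎)`. -/
theorem Δ_h_eq_map : P.W.Δ P.h = TensorProduct.map
    (LinearMap.mulLeft ℂ P.g ∘ₗ LinearMap.mulRight ℂ P.g ∘ₗ P.W.S.toLinearMap)
    P.W.S.toLinearMap (P.W.Δ P.h) := by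
  have h1 : TensorProduct.comm ℂ A A (P.W.Δ P.h)
      = TensorProduct.map P.W.S.toLinearMap P.W.S.toLinearMap (P.W.Δ P.h) := by
    conv_lhs => rw [← P.haar_S, P.W.S_anticomul]
    exact (TensorProduct.comm ℂ A A).symm_apply_apply _
  have h2 : ∀ u : A ⊗[ℂ] A, TensorProduct.comm ℂ A A (TensorProduct.map LinearMap.id
      (LinearMap.mulLeft ℂ P.g ∘ₗ LinearMap.mulRight ℂ P.g) u) = TensorProduct.map
      (LinearMap.mulLeft ℂ P.g ∘ₗ LinearMap.mulRight ℂ P.g) LinearMap.id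
      (TensorProduct.comm ℂ A A u) := fun u => (TensorProduct.map_comm _ _ u).symm
  have h3 := congrArg (TensorProduct.comm ℂ A A) P.haar_flip
  rw [← g, h2, h1, ← LinearMap.comp_apply, ← TensorProduct.map_comp] at h3
  have h4 : TensorProduct.comm ℂ A A
      (TensorProduct.map P.W.S.toLinearMap P.W.S.toLinearMap (P.W.Δ P.h)) = P.W.Δ P.h := by
    rw [← P.W.S_anticomul, P.haar_S]
  exact h4.symm.trans h3.symm

theorem iotaEl_eq : P.iotaEl = LinearMap.mul' ℂ A (TensorProduct.map LinearMap.id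
    P.W.S.toLinearMap
      (P.W.Δ P.h * ((Ring.inverse P.gL * Ring.inverse P.gL) ⊗ₜ[ℂ] 1))) := by
  rw [← P.W.Δ_mul_one P.h, mul_assoc,
    ← (P.W.baseL.mul_mem P.gL_inv_mem_baseL P.gL_inv_mem_baseL).2, ← P.W.Δ_mul]
  rfl

/-- `S(ı) = S(h₍₁₎) S(gL⁻²) h₍₂₎`. -/
theorem S_iotaEl : P.W.S P.iotaEl = LinearMap.mul' ℂ A (TensorProduct.map
    (LinearMap.mulRight ℂ (P.W.S (Ring.inverse P.gL * Ring.inverse P.gL)) ∘ₗ P.W.S.toLinearMap)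
    LinearMap.id (P.W.Δ P.h)) := by
  have key : ∀ (y : A) (u : A ⊗[ℂ] A), P.W.S (LinearMap.mul' ℂ A (TensorProduct.map LinearMap.id
      P.W.S.toLinearMap (u * (y ⊗ₜ[ℂ] 1)))) = LinearMap.mul' ℂ A (TensorProduct.map
      (LinearMap.mulRight ℂ (P.W.S y) ∘ₗ P.W.S.toLinearMap) LinearMap.id
      (TensorProduct.comm ℂ A A
        (TensorProduct.map P.W.S.toLinearMap P.W.S.toLinearMap u))) := by
    intro y u
    induction u with
    | zero => simp
    | add u v hu hv => simp only [add_mul, map_add, hu, hv]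
    | tmul a b => simp [P.W.S_antimul, mul_assoc]
  rw [iotaEl_eq, key, ← P.W.S_anticomul, P.haar_S]

theorem iotaEl_eq_conj : P.iotaEl = P.g * P.W.S P.iotaEl * Ring.inverse P.g := by
  have key : ∀ u : A ⊗[ℂ] A, LinearMap.mul' ℂ A (TensorProduct.map LinearMap.id
      P.W.S.toLinearMap (TensorProduct.map
        (LinearMap.mulLeft ℂ P.g ∘ₗ LinearMap.mulRight ℂ P.g ∘ₗ P.W.S.toLinearMap)
        P.W.S.toLinearMap u * ((Ring.inverse P.gL * Ring.inverse P.gL) ⊗ₜ[ℂ] 1)))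
      = P.g * LinearMap.mul' ℂ A (TensorProduct.map
      (LinearMap.mulRight ℂ (P.W.S (Ring.inverse P.gL * Ring.inverse P.gL)) ∘ₗ P.W.S.toLinearMap)
        LinearMap.id u) * Ring.inverse P.g := by
    intro u
    induction u with
    | zero => simp
    | add u v hu hv => simp only [add_mul, mul_add, map_add, hu, hv]
    | tmul a b =>
      have hS : P.W.S (P.W.S b) = P.g * b * Ring.inverse P.g := P.S_sq b
      simp [hS, ← g_mul_gL_inv_sq_mul_g, mul_assoc]
  rw [S_iotaEl, ← key, ← Δ_h_eq_map, ← iotaEl_eq]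

theorem iotaEl_mem_baseL : P.iotaEl ∈ P.W.baseL := P.W.εL_mem_baseL _

theorem iotaEl_mem_baseR : P.iotaEl ∈ P.W.baseR := by
  have hS : P.W.S P.iotaEl ∈ P.W.baseR := P.W.S_mem_baseR P.iotaEl_mem_baseL
  have hinv : Ring.inverse P.g = P.gR * Ring.inverse P.gL := by
    rw [g, Ring.inverse_mul (Or.inl P.gL_unit), Ring.inverse_inverse P.gR_unit]
  have h : P.iotaEl = Ring.inverse P.gR * P.W.S P.iotaEl * P.gR := by
    refine P.iotaEl_eq_conj.trans ?_
    rw [hinv, g, (P.W.commute_of_mem P.gL_mem_baseL P.gR_inv_mem_baseR).eq, mul_assoc _ P.gL,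
      (P.W.commute_of_mem P.gL_mem_baseL hS).eq, mul_assoc, mul_assoc, ← mul_assoc P.gL,
      (P.W.commute_of_mem P.gL_mem_baseL P.gR_mem_baseR).eq,
      Ring.mul_inverse_cancel_right _ _ P.gL_unit, mul_assoc]
  rw [h]
  exact P.W.baseR.mul_mem (P.W.baseR.mul_mem P.gR_inv_mem_baseR hS) P.gR_mem_baseR

theorem iotaEl_isPosElem : IsPosElem P.iotaEl := by
  have h1 : P.iotaEl * P.h
      = star (Ring.inverse P.gL * P.h) * (Ring.inverse P.gL * P.h) := by
    rw [iotaEl, ← P.haar_left, star_mul, P.haar_star, star_gL_inv]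
    simp only [mul_assoc]
  have h2 : rapp P.hHat (P.W.Δ (P.iotaEl * P.h)) = P.iotaEl * (P.gL * P.gL) := by
    rw [P.W.Δ_mul, P.iotaEl_mem_baseL.1, mul_assoc, P.W.Δ_one_mul, rapp_tmul_one_mul, P.gL_sq]
  have h3 := P.W.isPosElem_rapp_Δ P.hHat_pos (Ring.inverse P.gL * P.h)
  rw [← h1, h2, ← mul_assoc, ← (P.W.commute_of_mem P.gL_mem_baseL P.iotaEl_mem_baseR).eq] at h3
  have h4 := h3.star_mul_mul (Ring.inverse P.gL)
  rwa [star_gL_inv, mul_assoc, Ring.mul_inverse_cancel_right _ _ P.gL_unit,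
    Ring.inverse_mul_cancel_left _ _ P.gL_unit] at h4

theorem jayEl_isPosElem : IsPosElem P.jayEl := by
  have h := P.W.isPosElem_lapp_Δ P.hHat_pos (Ring.inverse P.gL)
  rwa [star_gL_inv] at h

theorem jayEl_mem_baseL : P.jayEl ∈ P.W.baseL := by
  rw [jayEl, (P.W.baseL.mul_mem P.gL_inv_mem_baseL P.gL_inv_mem_baseL).1, lapp_tmul_one_mul]
  exact P.W.lapp_Δ_one_mem_baseL _

/-- The dual Haar integral slices every coproduct into the right base algebra. -/
theorem lapp_hHat_Δ_mem_baseR (x : A) : lapp P.hHat (P.W.Δ x) ∈ P.W.baseR := by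
  obtain ⟨-, ψ, -, rfl⟩ := P.haar_nondeg x
  rw [Δ_rapp, lapp_rapp_assoc, ← coassoc_apply, ← Δ_lapp, ← P.gR_sq,
    (P.W.baseR.mul_mem P.gR_mem_baseR P.gR_mem_baseR).2, rapp_mul_one_tmul]
  exact P.W.rapp_Δ_one_mem_baseR _

theorem jayEl_mem_baseR : P.jayEl ∈ P.W.baseR := P.lapp_hHat_Δ_mem_baseR _

theorem sqrt_mem {x : A} (hx : IsPosElem x) {B : Subalgebra ℂ A} (hB : x ∈ B) :
    P.sqrt x ∈ B :=
  (P.sqrt_pos x hx).mem_of_mul_self B ((P.sqrt_mul_self x hx).symm ▸ hB)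

theorem S_ξL : P.W.S P.ξL = P.ξR := by
  have hi := P.W.S_eq_self (P.sqrt_mem P.iotaEl_isPosElem P.iotaEl_mem_baseL)
    (P.sqrt_mem P.iotaEl_isPosElem P.iotaEl_mem_baseR)
  have hj := P.W.S_eq_self (P.sqrt_mem P.jayEl_isPosElem P.jayEl_mem_baseL)
    (P.sqrt_mem P.jayEl_isPosElem P.jayEl_mem_baseR)
  have hij := (P.W.commute_of_mem (P.sqrt_mem P.iotaEl_isPosElem P.iotaEl_mem_baseL)
    (P.sqrt_mem P.jayEl_isPosElem P.jayEl_mem_baseR)).eq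
  have hc := (P.W.commute_of_mem (P.W.baseL.mul_mem
    (P.sqrt_mem P.iotaEl_isPosElem P.iotaEl_mem_baseL)
    (P.sqrt_mem P.jayEl_isPosElem P.jayEl_mem_baseL)) P.gR_mem_baseR).eq
  rw [ξL, ξR, P.W.S_antimul, P.W.S_antimul, ← P.gR_S, hi, hj, ← hij, hc]

theorem ξL_mem_baseL : P.ξL ∈ P.W.baseL :=
  P.W.baseL.mul_mem (P.W.baseL.mul_mem (P.sqrt_mem P.iotaEl_isPosElem P.iotaEl_mem_baseL)
    (P.sqrt_mem P.jayEl_isPosElem P.jayEl_mem_baseL)) P.gL_mem_baseL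

theorem ξR_mem_baseR : P.ξR ∈ P.W.baseR :=
  P.W.baseR.mul_mem (P.W.baseR.mul_mem (P.sqrt_mem P.iotaEl_isPosElem P.iotaEl_mem_baseR)
    (P.sqrt_mem P.jayEl_isPosElem P.jayEl_mem_baseR)) P.gR_mem_baseR

theorem commute_g_ξL : Commute P.g P.ξL := by
  have hgL : Commute P.gL P.ξL :=
    (((P.W.commute_of_mem P.gL_mem_baseL
        (P.sqrt_mem P.iotaEl_isPosElem P.iotaEl_mem_baseR)).mul_right
      (P.W.commute_of_mem P.gL_mem_baseL
        (P.sqrt_mem P.jayEl_isPosElem P.jayEl_mem_baseR))).mul_right (Commute.refl _))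
  exact hgL.mul_left (P.W.commute_of_mem P.ξL_mem_baseL P.gR_inv_mem_baseR).symm

theorem S_ξR : P.W.S P.ξR = P.ξL := by
  have hS : P.W.S (P.W.S P.ξL) = P.g * P.ξL * Ring.inverse P.g := P.S_sq P.ξL
  rw [← S_ξL, hS, P.commute_g_ξL.eq]
  exact Ring.mul_inverse_cancel_right P.g P.ξL P.g_unit

end HaarPkg

/-- **Exchange identities for `ξ_L` and `ξ_R`.**
There exist functionals `ξ̂_L, ξ̂_R ∈ A*` such that for all `x ∈ A`:
`ξ_R x = ⟨ξ̂_L, x₍₂₎⟩ x₍₁₎`, `ξ_L x = ⟨ξ̂_L, x₍₁₎⟩ x₍₂₎`,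
`x ξ_L = ⟨ξ̂_R, x₍₁₎⟩ x₍₂₎`, and `x ξ_R = ⟨ξ̂_R, x₍₂₎⟩ x₍₁₎`. -/
theorem HaarPkg.xi_exchange {A : Type*} [NormedRing A] [StarRing A] [CStarRing A]
    [NormedAlgebra ℂ A] [StarModule ℂ A] [FiniteDimensional ℂ A]
    (P : HaarPkg A) :
    ∃ ξhatL ξhatR : A →ₗ[ℂ] ℂ, ∀ x : A,
      P.ξR * x = rapp ξhatL (P.W.Δ x) ∧
      P.ξL * x = lapp ξhatL (P.W.Δ x) ∧
      x * P.ξL = lapp ξhatR (P.W.Δ x) ∧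
      x * P.ξR = rapp ξhatR (P.W.Δ x) := by
  refine ⟨P.W.ε ∘ₗ LinearMap.mulLeft ℂ P.ξR, P.W.ε ∘ₗ LinearMap.mulRight ℂ P.ξL, fun x => ?_⟩
  have hL : P.W.ε ∘ₗ LinearMap.mulLeft ℂ P.ξR = P.W.ε ∘ₗ LinearMap.mulLeft ℂ P.ξL :=
    LinearMap.ext fun x => by
      simp only [LinearMap.comp_apply, LinearMap.mulLeft_apply]
      rw [P.W.ε_mul_eq_εR P.ξL, P.W.εR_eq_S P.ξL_mem_baseL, P.S_ξL]
  have hR : P.W.ε ∘ₗ LinearMap.mulRight ℂ P.ξR = P.W.ε ∘ₗ LinearMap.mulRight ℂ P.ξL :=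
    LinearMap.ext fun x => by
      simp only [LinearMap.comp_apply, LinearMap.mulRight_apply]
      rw [P.W.ε_mul_eq_εL x P.ξR, P.W.εL_eq_S P.ξR_mem_baseR, P.S_ξR]
  refine ⟨?_, ?_, ?_, ?_⟩
  · rw [WeakHopfData.rapp_mulLeft_Δ P.ξR_mem_baseR]
  · rw [hL, WeakHopfData.lapp_mulLeft_Δ P.ξL_mem_baseL]
  · rw [WeakHopfData.lapp_mulRight_Δ P.ξL_mem_baseL]
  · rw [← hR, WeakHopfData.rapp_mulRight_Δ P.ξR_mem_baseR]

end
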